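/- arXiv:0806.4009 — 2 statements merged into one kernel-verified Lean document; each statement's English description precedes it below -/
import Mathlib

section
/- Unique decomposition of 2-indecomposable continua: Let X be a 2-indecomposable continuum (a nonempty compact connected metric space that is decomposable but not the essential union of three proper subcontinua). Then there exists a decomposition (A, B) of X in which both A and B are indecomposable; moreover, for every decomposition (C, D) of X, each of C and D contains exactly one of A and B. -/
open Set Metric Filter Topology

/-- A space is locally homeomorphic to ℝ²: every point has an open
neighborhood homeomorphic to the Euclidean plane. -/
def LocallyEuclidean2 (S : Type*) [TopologicalSpace S] : Prop :=
  ∀ x : S, ∃ U : Set S, IsOpen U ∧ x ∈ U ∧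
    Nonempty (U ≃ₜ EuclideanSpace ℝ (Fin 2))

section Defs

variable {S : Type*} [TopologicalSpace S]

/-- A continuum: a nonempty compact connected subset. -/
def IsContinuum (X : Set S) : Prop := IsCompact X ∧ IsConnected X

/-- A complementary domain of `X`: a connected component of the complement of `X`. -/
def IsComplementaryDomain (X U : Set S) : Prop :=
  ∃ x, x ∉ X ∧ U = connectedComponentIn Xᶜ x

/-- A proper subcontinuum of `X`. -/
def IsProperSubcontinuum (X A : Set S) : Prop :=
  A.Nonempty ∧ IsClosed A ∧ IsConnected A ∧ A ⊆ X ∧ A ≠ X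

/-- `X` is decomposable: the union of two proper subcontinua. -/
def IsDecomposable (X : Set S) : Prop :=
  ∃ A B, IsProperSubcontinuum X A ∧ IsProperSubcontinuum X B ∧ A ∪ B = X

/-- `X` is the essential union of three proper subcontinua. -/
def IsEssentialUnionOfThree (X : Set S) : Prop :=
  ∃ X₁ X₂ X₃, IsProperSubcontinuum X X₁ ∧ IsProperSubcontinuum X X₂ ∧
    IsProperSubcontinuum X X₃ ∧ X₁ ∪ X₂ ∪ X₃ = X ∧
    ¬ X₁ ⊆ X₂ ∪ X₃ ∧ ¬ X₂ ⊆ X₁ ∪ X₃ ∧ ¬ X₃ ⊆ X₁ ∪ X₂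

/-- `X` is 2-indecomposable: decomposable but not the essential union of
three proper subcontinua. -/
def Is2Indecomposable (X : Set S) : Prop :=
  IsDecomposable X ∧ ¬ IsEssentialUnionOfThree X

/-- `X` is shielded: no complementary domain has frontier equal to `X`. -/
def IsShielded (X : Set S) : Prop :=
  ∀ U, IsComplementaryDomain X U → frontier U ≠ X

/-- A generalized crosscut of `U`. -/
def IsGenCrosscut (U A : Set S) : Prop :=
  A ⊆ U ∧ Nonempty (A ≃ₜ Set.Ioo (0:ℝ) 1) ∧ closure A \ A ⊆ frontier U

/-- `T` is a shadow of the (generalized) crosscut `A` of `U`. -/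
def IsShadowOf (U A T : Set S) : Prop :=
  ∃ x ∈ U \ A, T = closure (connectedComponentIn (U \ A) x) ∩ frontier U

/-- An arc with endpoints `a` and `b`. -/
def IsArcFrom (A : Set S) (a b : S) : Prop :=
  ∃ f : Set.Icc (0:ℝ) 1 → S, Continuous f ∧ Function.Injective f ∧
    Set.range f = A ∧ f ⟨0, by norm_num⟩ = a ∧ f ⟨1, by norm_num⟩ = b

/-- A crosscut of `U`: a copy of `(0,1)` in `U` whose closure is an arc
meeting the frontier of `U` exactly at the endpoints of the arc. -/
def IsCrosscut (U K : Set S) : Prop :=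
  K ⊆ U ∧ Nonempty (K ≃ₜ Set.Ioo (0:ℝ) 1) ∧
    ∃ a b, IsArcFrom (closure K) a b ∧ closure K ∩ frontier U = {a, b}

/-- A closed disk: a set homeomorphic to the closed unit disk in ℝ². -/
def IsClosedDisk (D : Set S) : Prop :=
  Nonempty (D ≃ₜ Metric.closedBall (0 : EuclideanSpace ℝ (Fin 2)) 1)

/-- A cat's cradle between `d₁` and `d₃`: a family of arcs from `d₁` to `d₃`
whose interiors are pairwise disjoint. -/
def IsCatsCradle {ι : Type*} (d₁ d₃ : S) (A : ι → Set S) : Prop :=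
  (∀ i, IsArcFrom (A i) d₁ d₃) ∧
    Pairwise fun i j => (A i \ {d₁, d₃}) ∩ (A j \ {d₁, d₃}) = ∅

/-- A cat's cradle between `d₁` and `d₃` through `D₂`. -/
def IsCatsCradleThrough {ι : Type*} (d₁ d₃ : S) (D₂ : Set S) (A : ι → Set S) : Prop :=
  IsCatsCradle d₁ d₃ A ∧ D₂ ∩ {d₁, d₃} = ∅ ∧ ∀ i, (A i ∩ D₂).Nonempty

/-- A chord of the closed disk `D`: an arc in `D` meeting the frontier of `D`
exactly at its two endpoints. -/
def IsChord (D A : Set S) : Prop :=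
  ∃ a b, IsArcFrom A a b ∧ A ⊆ D ∧ A ∩ frontier D = {a, b}

/-- A sequence of pairwise disjoint chords of `D` is linearly ordered if each
middle chord separates the earlier ones from the later ones in `D`. -/
def LinearlyOrderedChords (D : Set S) (A : ℕ → Set S) : Prop :=
  (Pairwise fun i j => Disjoint (A i) (A j)) ∧
    ∀ i j k, i < j → j < k → ∀ x ∈ A i, ∀ y ∈ A k,
      connectedComponentIn (D \ A j) x ≠ connectedComponentIn (D \ A j) y

end Defs

section MetricDefs

variable {S : Type*} [MetricSpace S]

/-- Convergence of a sequence of sets to `X` in the Hausdorff metric. -/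
def HausdorffConvergesTo (A : ℕ → Set S) (X : Set S) : Prop :=
  Tendsto (fun n => hausdorffDist (A n) X) atTop (𝓝 0)

/-- The double-pass condition for a sequence of domains. -/
def DoublePassCondition (X : Set S) (U : ℕ → Set S) : Prop :=
  ∀ K : ℕ → Set S, (∀ n, IsGenCrosscut (U n) (K n)) →
    ∃ Sh : ℕ → Set S, (∀ n, IsShadowOf (U n) (K n) (Sh n)) ∧ HausdorffConvergesTo Sh X

/-- The double-pass condition with (genuine) crosscuts. -/
def DoublePassConditionCrosscuts (X : Set S) (U : ℕ → Set S) : Prop :=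
  ∀ K : ℕ → Set S, (∀ n, IsCrosscut (U n) (K n)) →
    ∃ Sh : ℕ → Set S, (∀ n, IsShadowOf (U n) (K n) (Sh n)) ∧ HausdorffConvergesTo Sh X

end MetricDefs

/-- The working form of "not an essential union of three proper subcontinua". -/
def TripleProp (X : Type*) [TopologicalSpace X] : Prop :=
  ∀ P Q R : Set X, IsClosed P → IsClosed Q → IsClosed R → IsConnected P → IsConnected Q →
    IsConnected R → P ∪ Q ∪ R = univ → P ∪ Q = univ ∨ P ∪ R = univ ∨ Q ∪ R = univ

theorem tripleProp_of {X : Type*} [TopologicalSpace X]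
    (h : ¬ IsEssentialUnionOfThree (univ : Set X)) : TripleProp X := by
  intro P Q R cP cQ cR kP kQ kR hU
  by_contra! hc
  obtain ⟨h1, h2, h3⟩ := hc
  refine h ⟨P, Q, R, ⟨kP.nonempty, cP, kP, subset_univ _, ?_⟩,
    ⟨kQ.nonempty, cQ, kQ, subset_univ _, ?_⟩, ⟨kR.nonempty, cR, kR, subset_univ _, ?_⟩, hU,
    ?_, ?_, ?_⟩
  · rintro rfl; simp at h1
  · rintro rfl; simp at h1
  · rintro rfl; simp at h2
  · intro hs; apply h3; rw [← hU, union_assoc, union_eq_self_of_subset_left hs]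
  · intro hs; apply h2; rw [← hU]; ext x; have := @hs x; simp at *; tauto
  · intro hs; apply h1; rw [← hU]; ext x; have := @hs x; simp at *; tauto

theorem conn_side {X : Type*} [TopologicalSpace X] {K F G : Set X}
    (cK : IsClosed K) (cF : IsClosed F) (cG : IsClosed G) (kK : IsConnected K)
    (kU : IsPreconnected (K ∪ F ∪ G)) (hd : ∀ x, x ∈ F → x ∈ G → False) :
    IsConnected (K ∪ F) := by
  refine ⟨kK.nonempty.mono subset_union_left, ?_⟩
  have key : ∀ u v : Set X, IsClosed u → IsClosed v → K ∪ F ⊆ u ∪ v →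
      (K ∪ F) ∩ (u ∩ v) = ∅ → K ⊆ u → K ∪ F ⊆ u := by
    intro u v hu hv hs hdis hK
    obtain ⟨k, hk⟩ := kK.nonempty
    have h' := isPreconnected_closed_iff.1 kU ((u ∩ (K ∪ F)) ∪ G) (v ∩ (K ∪ F))
      ((hu.inter (cK.union cF)).union cG) (hv.inter (cK.union cF))
      (by
        rintro x (hx | hx)
        · rcases hs hx with h | h
          · exact Or.inl (Or.inl ⟨h, hx⟩)
          · exact Or.inr ⟨h, hx⟩
        · exact Or.inl (Or.inr hx))
      ⟨k, Or.inl (Or.inl hk), Or.inl ⟨hK hk, Or.inl hk⟩⟩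
    intro x hx
    by_contra hxu
    have hxv : x ∈ v := (hs hx).resolve_left hxu
    obtain ⟨y, -, hy1, hyv, hyKF⟩ := h' ⟨x, Or.inl hx, hxv, hx⟩
    have hyu : y ∉ u := fun hyu => by
      have : y ∈ (K ∪ F) ∩ (u ∩ v) := ⟨hyKF, hyu, hyv⟩
      rw [hdis] at this; exact this
    rcases hy1 with h | h
    · exact hyu h.1
    · rcases hyKF with h2 | h2
      · exact hyu (hK h2)
      · exact hd y h2 h
  rw [isPreconnected_iff_subset_of_disjoint_closed]
  intro u v hu hv hs hdis
  have hKd : K ∩ (u ∩ v) = ∅ := by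
    apply subset_eq_empty _ hdis
    exact inter_subset_inter_left _ subset_union_left
  rcases (isPreconnected_iff_subset_of_disjoint_closed.1 kK.isPreconnected) u v hu hv
    (subset_union_left.trans hs) hKd with h | h
  · exact Or.inl (key u v hu hv hs hdis h)
  · refine Or.inr (key v u hv hu (by rwa [union_comm v u]) (by rwa [inter_comm v u]) h)

/-- Criterion: a closed set is preconnected if every disjoint closed splitting is trivial. -/
theorem preconn_of {X : Type*} [TopologicalSpace X] {E : Set X} (cE : IsClosed E)
    (h : ∀ F G : Set X, IsClosed F → IsClosed G → F ∪ G = E → (∀ x, x ∈ F → x ∈ G → False) →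
      E ⊆ F ∨ E ⊆ G) : IsPreconnected E := by
  rw [isPreconnected_iff_subset_of_disjoint_closed]
  intro u v hu hv hs hdis
  rcases h (E ∩ u) (E ∩ v) (cE.inter hu) (cE.inter hv)
    (by rw [← inter_union_distrib_left]; exact inter_eq_left.2 hs)
    (fun x h1 h2 => by
      have : x ∈ E ∩ (u ∩ v) := ⟨h1.1, h1.2, h2.2⟩
      rw [hdis] at this; exact this) with h | h
  · exact Or.inl (h.trans inter_subset_right)
  · exact Or.inr (h.trans inter_subset_right)

theorem closure_compl_sub {X : Type*} [TopologicalSpace X] {D F : Set X} (cF : IsClosed F)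
    (h : D ∪ F = univ) : closure Dᶜ ⊆ F := by
  refine closure_minimal (fun x hx => ?_) cF
  have : x ∈ D ∪ F := by rw [h]; trivial
  exact this.resolve_left hx

theorem union_closure_compl {X : Type*} [TopologicalSpace X] (D : Set X) :
    D ∪ closure Dᶜ = univ := by
  ext x
  by_cases hx : x ∈ D
  · simp [hx]
  · exact iff_of_true (Or.inr (subset_closure hx)) trivial

theorem piece_preconn {X : Type*} [TopologicalSpace X] [ConnectedSpace X]
    (hT : TripleProp X) {D F G : Set X} (cD : IsClosed D) (kD : IsConnected D)
    (cF : IsClosed F) (cG : IsClosed G) (hFG : F ∪ G = closure Dᶜ)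
    (hd : ∀ x, x ∈ F → x ∈ G → False) (hF : D ∪ F ≠ univ) : IsPreconnected F := by
  have hU : D ∪ (F ∪ G) = univ := by rw [hFG]; exact union_closure_compl D
  apply preconn_of cF
  intro F1 F2 c1 c2 h12 hd'
  subst h12
  have p : ∀ S T : Set X, D ∪ S ∪ T = univ → IsPreconnected (D ∪ S ∪ T) := by
    intro S T h; rw [h]; exact isPreconnected_univ
  have k1 : IsConnected (D ∪ F1) := conn_side cD c1 (c2.union cG) kD
    (p _ _ (by rw [← hU]; ext x; simp; tauto))
    (fun x h1 h2 => h2.elim (hd' x h1) (hd x (Or.inl h1)))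
  have k2 : IsConnected (D ∪ F2) := conn_side cD c2 (c1.union cG) kD
    (p _ _ (by rw [← hU]; ext x; simp; tauto))
    (fun x h1 h2 => h2.elim (fun h => hd' x h h1) (hd x (Or.inr h1)))
  have k3 : IsConnected (D ∪ G) := conn_side cD cG cF kD
    (p _ _ (by rw [← hU]; ext x; simp; tauto))
    (fun x h1 h2 => hd x h2 h1)
  rcases hT _ _ _ (cD.union c1) (cD.union c2) (cD.union cG) k1 k2 k3
    (by rw [← hU]; ext x; simp; tauto) with h | h | h
  · exact absurd (by rw [← h]; ext x; simp; tauto) hF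
  · left
    have := closure_compl_sub (D := D) (F := F1 ∪ G) (c1.union cG)
      (by rw [← h]; ext x; simp; tauto)
    rw [← hFG] at this
    intro x hx
    exact (this (Or.inl hx)).resolve_right (hd x hx)
  · right
    have := closure_compl_sub (D := D) (F := F2 ∪ G) (c2.union cG)
      (by rw [← h]; ext x; simp; tauto)
    rw [← hFG] at this
    intro x hx
    exact (this (Or.inl hx)).resolve_right (hd x hx)

theorem closure_compl_preconn {X : Type*} [TopologicalSpace X] [ConnectedSpace X]
    (hT : TripleProp X) {D : Set X} (cD : IsClosed D) (kD : IsConnected D) :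
    IsPreconnected (closure Dᶜ) := by
  apply preconn_of isClosed_closure
  intro F G cF cG hFG hd
  have hU : D ∪ (F ∪ G) = univ := by rw [hFG]; exact union_closure_compl D
  by_cases hF : D ∪ F = univ
  · exact Or.inl (closure_compl_sub cF hF)
  by_cases hG : D ∪ G = univ
  · exact Or.inr (closure_compl_sub cG hG)
  exfalso
  have pF := piece_preconn hT cD kD cF cG hFG hd hF
  have pG := piece_preconn hT cD kD cG cF (by rwa [union_comm]) (fun x h1 h2 => hd x h2 h1) hG
  have nF : F.Nonempty := by
    by_contra h
    rw [not_nonempty_iff_eq_empty] at h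
    subst h; simp at hU; exact hG hU
  have nG : G.Nonempty := by
    by_contra h
    rw [not_nonempty_iff_eq_empty] at h
    subst h; simp at hU; exact hF hU
  rcases hT D F G cD cF cG kD ⟨nF, pF⟩ ⟨nG, pG⟩ (by rwa [union_assoc]) with h | h | h
  · exact hF h
  · exact hG h
  · obtain ⟨x, -, h1, h2⟩ := isPreconnected_closed_iff.1 (isPreconnected_univ (α := X)) F G cF cG
      h.ge (by simpa using nF) (by simpa using nG)
    exact hd x h1 h2

theorem closure_compl_conn {X : Type*} [TopologicalSpace X] [ConnectedSpace X]
    (hT : TripleProp X) {D : Set X} (cD : IsClosed D) (kD : IsConnected D) (hD : D ≠ univ) :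
    IsConnected (closure Dᶜ) :=
  ⟨(nonempty_compl.2 hD).closure, closure_compl_preconn hT cD kD⟩

theorem disj_case {X : Type*} [TopologicalSpace X] [ConnectedSpace X]
    (hT : TripleProp X) {A C : Set X} (cA : IsClosed A) (kA : IsConnected A)
    (cC : IsClosed C) (kC : IsConnected C) (hA : closure Aᶜ ≠ univ) (hC : closure Cᶜ ≠ univ)
    (hd : ∀ x, x ∈ A → x ∈ C → False) : False := by
  have hAC : A ∪ C ≠ univ := by
    intro h
    obtain ⟨x, -, h1, h2⟩ := isPreconnected_closed_iff.1 (isPreconnected_univ (α := X)) A C cA cC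
      h.ge (by simpa using kA.nonempty) (by simpa using kC.nonempty)
    exact hd x h1 h2
  have hU := union_closure_compl (A ∪ C)
  have e1 : A ∪ closure (A ∪ C)ᶜ = closure Cᶜ := by
    apply Subset.antisymm
    · apply union_subset
      · exact fun x hx => subset_closure (fun h => hd x hx h)
      · exact closure_mono (compl_subset_compl.2 subset_union_right)
    · exact closure_compl_sub (cA.union isClosed_closure) (by rw [← hU]; ext x; simp; tauto)
  have e2 : C ∪ closure (A ∪ C)ᶜ ⊆ closure Aᶜ := by
    apply union_subset
    · exact fun x hx => subset_closure (fun h => hd x h hx)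
    · exact closure_mono (compl_subset_compl.2 subset_union_left)
  have pE : IsPreconnected (closure (A ∪ C)ᶜ) := by
    apply preconn_of isClosed_closure
    intro F G cF cG hFG hd'
    have pU : IsPreconnected (A ∪ (F ∪ G)) := by
      rw [hFG, e1]; exact closure_compl_preconn hT cC kC
    rw [← hFG] at e1 hU
    have k1 : IsConnected (A ∪ F) := conn_side cA cF cG kA (by rwa [union_assoc]) hd'
    have k2 : IsConnected (A ∪ G) := conn_side cA cG cF kA
      (by rwa [union_assoc, union_comm G F]) (fun x h1 h2 => hd' x h2 h1)
    rcases hT _ _ _ (cA.union cF) (cA.union cG) cC k1 k2 kC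
      (by rw [← hU]; ext x; simp; tauto) with h | h | h
    · exact absurd (by rw [← e1, ← h]; ext x; simp; tauto) hC
    · exact Or.inl (closure_compl_sub cF (by rw [← h]; ext x; simp; tauto))
    · exact Or.inr (closure_compl_sub cG (by rw [← h]; ext x; simp; tauto))
  rcases hT _ _ _ cA cC isClosed_closure kA kC ⟨(nonempty_compl.2 hAC).closure, pE⟩ hU
    with h | h | h
  · exact hAC h
  · exact hC (by rw [← e1, h])
  · exact hA (univ_subset_iff.1 (h ▸ e2))

theorem half {X : Type*} [TopologicalSpace X] [ConnectedSpace X]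
    (hT : TripleProp X) {A B C D : Set X} (cA : IsClosed A) (kA : IsConnected A)
    (cB : IsClosed B) (kB : IsConnected B) (hA : A ≠ univ) (hB : B ≠ univ)
    (hAB : closure Aᶜ = B) (hBA : closure Bᶜ = A)
    (cC : IsClosed C) (kC : IsConnected C) (cD : IsClosed D) (hD : D ≠ univ)
    (hCD : C ∪ D = univ) : A ∪ C = univ ∨ B ∪ C = univ := by
  by_contra! hc
  obtain ⟨h1, h2⟩ := hc
  have hCc : closure Cᶜ ⊆ D := closure_compl_sub cD hCD
  have hCu : closure Cᶜ ≠ univ := fun h => hD (univ_subset_iff.1 (h ▸ hCc))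
  have mA : (A ∩ C).Nonempty := by
    by_contra h
    exact disj_case hT cA kA cC kC (by rwa [hAB]) hCu (fun x h3 h4 => h ⟨x, h3, h4⟩)
  have mB : (B ∩ C).Nonempty := by
    by_contra h
    exact disj_case hT cB kB cC kC (by rwa [hBA]) hCu (fun x h3 h4 => h ⟨x, h3, h4⟩)
  have kP := closure_compl_conn hT (cA.union cC) (kA.union mA kC) h1
  have kQ := closure_compl_conn hT (cB.union cC) (kB.union mB kC) h2
  have hP : closure (A ∪ C)ᶜ ⊆ B := by
    rw [← hAB]; exact closure_mono (compl_subset_compl.2 subset_union_left)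
  have hQ : closure (B ∪ C)ᶜ ⊆ A := by
    rw [← hBA]; exact closure_mono (compl_subset_compl.2 subset_union_left)
  have hP' : closure (A ∪ C)ᶜ ⊆ D :=
    (closure_mono (compl_subset_compl.2 subset_union_right)).trans hCc
  have hQ' : closure (B ∪ C)ᶜ ⊆ D :=
    (closure_mono (compl_subset_compl.2 subset_union_right)).trans hCc
  set P := closure (A ∪ C)ᶜ with hPdef
  set Q := closure (B ∪ C)ᶜ with hQdef
  have cP : IsClosed P := isClosed_closure
  have cQ : IsClosed Q := isClosed_closure
  have uP : A ∪ C ∪ P = univ := union_closure_compl _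
  have uQ : B ∪ C ∪ Q = univ := union_closure_compl _
  have s1 : B ⊆ C ∪ P ∪ Q := by
    rw [← hAB]
    exact closure_compl_sub ((cC.union cP).union cQ) (by rw [← univ_subset_iff, ← uP]; grind)
  have hcov : C ∪ P ∪ Q = univ := by
    rw [← univ_subset_iff, ← uQ]
    grind
  rcases hT _ _ _ cC cP cQ kC kP kQ hcov with h | h | h
  · exact h2 (by rw [← univ_subset_iff, ← h]; grind)
  · exact h1 (by rw [← univ_subset_iff, ← h]; grind)
  · exact hD (by rw [← univ_subset_iff, ← h]; grind)

theorem indec {X : Type*} [TopologicalSpace X] 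
    (hT : TripleProp X) {A B : Set X} (cB : IsClosed B) (kB : IsConnected B) (hA : A ≠ univ)
    (hU : A ∪ B = univ) (hBA : closure Bᶜ = A) : ¬ IsDecomposable A := by
  rintro ⟨P, Q, ⟨-, cP, kP, sP, nP⟩, ⟨-, cQ, kQ, sQ, nQ⟩, rfl⟩
  rcases hT _ _ _ cP cQ cB kP kQ kB hU with h | h | h
  · exact hA h
  · apply nP
    exact sP.antisymm (hBA ▸ closure_compl_sub cP (by rwa [union_comm]))
  · apply nQ
    exact sQ.antisymm (hBA ▸ closure_compl_sub cQ (by rwa [union_comm]))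

/-- **Unique decomposition of 2-indecomposable continua.** A 2-indecomposable
continuum `X` admits a decomposition `(A, B)` into indecomposable subcontinua;
moreover every decomposition `(C, D)` of `X` is such that each of `C` and `D`
contains exactly one of `A` and `B`. -/
theorem two_indecomposable_unique_decomposition
    {X : Type*} [MetricSpace X] [CompactSpace X] [ConnectedSpace X] [Nonempty X]
    (h2 : Is2Indecomposable (Set.univ : Set X)) :
    ∃ A B : Set X,
      IsProperSubcontinuum Set.univ A ∧ IsProperSubcontinuum Set.univ B ∧
      A ∪ B = Set.univ ∧ ¬ IsDecomposable A ∧ ¬ IsDecomposable B ∧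
      ∀ C D : Set X,
        IsProperSubcontinuum Set.univ C → IsProperSubcontinuum Set.univ D →
        C ∪ D = Set.univ →
        (Xor' (A ⊆ C) (B ⊆ C) ∧ Xor' (A ⊆ D) (B ⊆ D)) := by
  obtain ⟨⟨C₀, D₀, ⟨-, cC, kC, -, nC⟩, ⟨-, cD, kD, -, nD⟩, hCD⟩, h3⟩ := h2
  have hT := tripleProp_of h3
  obtain ⟨A, hAdef⟩ : ∃ A, A = closure D₀ᶜ := ⟨_, rfl⟩
  obtain ⟨B, hBdef⟩ : ∃ B, B = closure Aᶜ := ⟨_, rfl⟩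
  have cA : IsClosed A := hAdef ▸ isClosed_closure
  have cB : IsClosed B := hBdef ▸ isClosed_closure
  have kA : IsConnected A := hAdef ▸ closure_compl_conn hT cD kD nD
  have sA : A ⊆ C₀ := hAdef ▸ closure_compl_sub cC (by rwa [union_comm])
  have nA : A ≠ univ := fun h => nC (univ_subset_iff.1 (h ▸ sA))
  have kB : IsConnected B := hBdef ▸ closure_compl_conn hT cA kA nA
  have sB : B ⊆ D₀ := hBdef ▸ closure_compl_sub cD
    (by rw [union_comm, hAdef]; exact union_closure_compl D₀)
  have nB : B ≠ univ := fun h => nD (univ_subset_iff.1 (h ▸ sB))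
  have hU : A ∪ B = univ := hBdef ▸ union_closure_compl A
  have hBA : closure Bᶜ = A := by
    apply Subset.antisymm
    · exact closure_compl_sub cA (by rwa [union_comm])
    · rw [hAdef]; exact closure_mono (compl_subset_compl.2 sB)
  have fin : ∀ C D : Set X, IsProperSubcontinuum univ C → IsProperSubcontinuum univ D →
      C ∪ D = univ → Xor' (A ⊆ C) (B ⊆ C) := by
    rintro C D ⟨-, cC', kC', -, nC'⟩ ⟨-, cD', kD', -, nD'⟩ h
    have hn : ¬ (A ⊆ C ∧ B ⊆ C) := fun hh =>
      nC' (univ_subset_iff.1 (hU ▸ union_subset hh.1 hh.2))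
    have ho : B ⊆ C ∨ A ⊆ C := by
      rcases half hT cA kA cB kB nA nB hBdef.symm hBA cC' kC' cD' nD' h with h' | h'
      · exact Or.inl (hBdef ▸ closure_compl_sub cC' h')
      · exact Or.inr (hBA ▸ closure_compl_sub cC' h')
    unfold Xor'
    tauto
  refine ⟨A, B, ⟨kA.nonempty, cA, kA, subset_univ _, nA⟩, ⟨kB.nonempty, cB, kB, subset_univ _, nB⟩,
    hU, indec hT cB kB nA hU hBA, indec hT cA kA nB (by rwa [union_comm]) hBdef.symm, ?_⟩
  intro C D hC hD h
  exact ⟨fin C D hC hD h, fin D C hD hC (by rwa [union_comm])⟩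
end

section
/- Let U ⊆ ℂ be a connected, simply connected open set with nondegenerate frontier (the frontier of U contains more than one point), and let φ be a conformal isomorphism from U onto the open unit disk 𝔻 = {z ∈ ℂ : |z| < 1}, i.e., φ is holomorphic and injective on U with φ(U) = 𝔻. If (Kₙ) is a null sequence of crosscuts of U, then (φ(Kₙ)) is a null sequence of crosscuts of 𝔻; in particular, diam φ(Kₙ) → 0. -/
open Set Metric Filter Topology

noncomputable def circLen (Φ : ℂ → ℂ) (Ω : Set ℂ) (p : ℂ) (r : ℝ) : ENNReal :=
  ∫⁻ θ in Ioo (-Real.pi) Real.pi,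
    Ω.indicator (fun z => ENNReal.ofReal (r * ‖deriv Φ z‖)) (circleMap p r θ)

theorem circLen_image {Φ : ℂ → ℂ} {Ω : Set ℂ} (hΩ : IsOpen Ω) (hΦ : DifferentiableOn ℂ Φ Ω)
    {g : ℂ → ℝ} {M : ℝ} (hM : 0 ≤ M)
    (hg : ∀ z ∈ Ω, ∃ g' : ℂ →L[ℝ] ℝ, HasFDerivAt g g' (Φ z) ∧ ‖g'‖ ≤ M)
    (p : ℂ) {r : ℝ} (hr : 0 < r) :
    MeasureTheory.volume ((fun z => g (Φ z)) '' (sphere p r ∩ Ω)) ≤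
      ENNReal.ofReal M * circLen Φ Ω p r := by
  set S : Set ℝ := circleMap p r ⁻¹' Ω ∩ Ioo (-Real.pi) Real.pi with hS
  have hSo : IsOpen (circleMap p r ⁻¹' Ω) := hΩ.preimage (continuous_circleMap p r)
  have hSm : MeasurableSet S := hSo.measurableSet.inter measurableSet_Ioo
  have hsub : (fun z => g (Φ z)) '' (sphere p r ∩ Ω) ⊆
      (fun θ => g (Φ (circleMap p r θ))) '' S ∪ {g (Φ (circleMap p r Real.pi))} := by
    rintro _ ⟨z, ⟨hz, hzΩ⟩, rfl⟩
    have hz' : circleMap p r (Complex.arg (z - p)) = z := by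
      have h1 : ‖z - p‖ = r := by simpa [dist_eq_norm] using hz
      have := Complex.norm_mul_exp_arg_mul_I (z - p)
      rw [h1] at this
      simp [circleMap, this]
    by_cases hpi : Complex.arg (z - p) = Real.pi
    · right
      simp only [mem_singleton_iff]
      rw [← hpi, hz']
    · left
      refine ⟨Complex.arg (z - p), ⟨?_, Complex.neg_pi_lt_arg _,
        lt_of_le_of_ne (Complex.arg_le_pi _) hpi⟩, ?_⟩
      · simpa [hz'] using hzΩ
      · simp only [hz']
  have hd : ∀ θ ∈ S, ∃ d : ℝ, HasDerivAt (fun θ => g (Φ (circleMap p r θ))) d θ ∧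
      |d| ≤ M * (r * ‖deriv Φ (circleMap p r θ)‖) := by
    intro θ hθ
    obtain ⟨g', hg', hgM⟩ := hg _ hθ.1
    have h1 : HasDerivAt Φ (deriv Φ (circleMap p r θ)) (circleMap p r θ) :=
      (hΦ.differentiableAt (hΩ.mem_nhds hθ.1)).hasDerivAt
    have h2 := h1.scomp θ (hasDerivAt_circleMap p r θ)
    have h3 := hg'.comp_hasDerivAt θ h2
    refine ⟨_, h3, ?_⟩
    calc _ ≤ ‖g'‖ * ‖(circleMap 0 r θ * Complex.I) • deriv Φ (circleMap p r θ)‖ := g'.le_opNorm _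
      _ = ‖g'‖ * (r * ‖deriv Φ (circleMap p r θ)‖) := by
        simp [abs_of_pos hr]
      _ ≤ _ := by gcongr
  choose! d hd hdM using hd
  calc _ ≤ MeasureTheory.volume ((fun θ => g (Φ (circleMap p r θ))) '' S ∪
            {g (Φ (circleMap p r Real.pi))}) := MeasureTheory.measure_mono hsub
    _ ≤ MeasureTheory.volume ((fun θ => g (Φ (circleMap p r θ))) '' S) + 0 := by
        refine (MeasureTheory.measure_union_le _ _).trans ?_
        simp
    _ ≤ ∫⁻ θ in S, ENNReal.ofReal |(ContinuousLinearMap.toSpanSingleton ℝ (d θ)).det| := by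
        rw [add_zero]
        exact MeasureTheory.addHaar_image_le_lintegral_abs_det_fderiv _ hSm
          (fun θ hθ => (hd θ hθ).hasFDerivAt.hasFDerivWithinAt)
    _ ≤ ∫⁻ θ in S, ENNReal.ofReal M * ENNReal.ofReal (r * ‖deriv Φ (circleMap p r θ)‖) := by
        refine MeasureTheory.setLIntegral_mono' hSm fun θ hθ => ?_
        rw [← ENNReal.ofReal_mul hM]
        refine ENNReal.ofReal_le_ofReal ?_
        simpa using hdM θ hθ
    _ = ENNReal.ofReal M * ∫⁻ θ in S, ENNReal.ofReal (r * ‖deriv Φ (circleMap p r θ)‖) := by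
        rw [MeasureTheory.lintegral_const_mul' _ _ ENNReal.ofReal_ne_top]
    _ = _ := by
        congr 1
        rw [circLen, hS, ← MeasureTheory.Measure.restrict_restrict hSo.measurableSet,
          ← MeasureTheory.lintegral_indicator hSo.measurableSet]
        rfl

theorem circLen_area {Φ : ℂ → ℂ} {Ω : Set ℂ} (hΩ : IsOpen Ω) (hΦ : DifferentiableOn ℂ Φ Ω)
    (hi : InjOn Φ Ω) (p : ℂ) :
    ∫⁻ r in Ioi (0:ℝ), ∫⁻ θ in Ioo (-Real.pi) Real.pi, ENNReal.ofReal r *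
      Ω.indicator (fun z => ENNReal.ofReal (‖deriv Φ z‖ ^ 2)) (circleMap p r θ) =
      MeasureTheory.volume (Φ '' Ω) := by
  set F : ℂ → ENNReal := Ω.indicator (fun z => ENNReal.ofReal (‖deriv Φ z‖ ^ 2)) with hF
  have hFm : Measurable F :=
    (((measurable_deriv Φ).norm.pow_const 2).ennreal_ofReal).indicator hΩ.measurableSet
  have h1 : MeasureTheory.volume (Φ '' Ω) = ∫⁻ z, F z := by
    rw [hF, MeasureTheory.lintegral_indicator hΩ.measurableSet]
    rw [← MeasureTheory.lintegral_abs_det_fderiv_eq_addHaar_image MeasureTheory.volume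
      hΩ.measurableSet (f' := fun z => (ContinuousLinearMap.toSpanSingleton ℂ (deriv Φ z)).restrictScalars ℝ)
      (fun z hz => ((hΦ.differentiableAt (hΩ.mem_nhds hz)).hasDerivAt.hasFDerivAt.restrictScalars
        ℝ).hasFDerivWithinAt) hi]
    refine MeasureTheory.setLIntegral_congr_fun hΩ.measurableSet fun z hz => ?_
    simp [ContinuousLinearMap.det, LinearMap.det_restrictScalars,
      Algebra.norm_complex_eq, Complex.normSq_eq_norm_sq]
  rw [h1, ← MeasureTheory.lintegral_add_left_eq_self F p,
    ← Complex.lintegral_comp_polarCoord_symm, polarCoord_target,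
    MeasureTheory.Measure.volume_eq_prod, MeasureTheory.setLIntegral_prod]
  · simp only [smul_eq_mul, Complex.polarCoord_symm_apply, circleMap, Complex.exp_mul_I,
      Complex.ofReal_cos, Complex.ofReal_sin]
  · refine Measurable.aemeasurable ?_
    simp only [smul_eq_mul, Complex.polarCoord_symm_apply]
    refine Measurable.mul (by fun_prop) (hFm.comp ?_)
    fun_prop

theorem circLen_log {Φ : ℂ → ℂ} {Ω : Set ℂ} (hΩ : IsOpen Ω) (hΦ : DifferentiableOn ℂ Φ Ω)
    (hi : InjOn Φ Ω) (p : ℂ) {A : ℝ} (hA0 : 0 ≤ A)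
    (hA : MeasureTheory.volume (Φ '' Ω) ≤ ENNReal.ofReal A)
    {ρ₁ ρ₂ η : ℝ} (h1 : 0 < ρ₁) (h2 : ρ₁ < ρ₂) (hη : 0 < η)
    (hL : ∀ r ∈ Ioo ρ₁ ρ₂, ENNReal.ofReal η ≤ circLen Φ Ω p r) :
    η ^ 2 / (2 * Real.pi) * Real.log (ρ₂ / ρ₁) ≤ A := by
  have hpi := Real.pi_pos
  have hpt : ∀ r ∈ Ioo ρ₁ ρ₂, ENNReal.ofReal (η ^ 2 / (2 * Real.pi) * r⁻¹) ≤
      ∫⁻ θ in Ioo (-Real.pi) Real.pi, ENNReal.ofReal r *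
        Ω.indicator (fun z => ENNReal.ofReal (‖deriv Φ z‖ ^ 2)) (circleMap p r θ) := by
    intro r hr
    have hr0 : 0 < r := h1.trans hr.1
    set B := ∫⁻ θ in Ioo (-Real.pi) Real.pi, ENNReal.ofReal r *
        Ω.indicator (fun z => ENNReal.ofReal (‖deriv Φ z‖ ^ 2)) (circleMap p r θ) with hB
    have hle : circLen Φ Ω p r ≤ ENNReal.ofReal (η / 2) + ENNReal.ofReal (Real.pi * r / η) * B := by
      calc circLen Φ Ω p r ≤ ∫⁻ θ in Ioo (-Real.pi) Real.pi,
            (ENNReal.ofReal (η / (4 * Real.pi)) + ENNReal.ofReal (Real.pi * r / η) *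
            (ENNReal.ofReal r *
            Ω.indicator (fun z => ENNReal.ofReal (‖deriv Φ z‖ ^ 2)) (circleMap p r θ))) := by
            refine MeasureTheory.lintegral_mono fun θ => ?_
            by_cases hθ : circleMap p r θ ∈ Ω
            · simp only [indicator_of_mem hθ]
              rw [← ENNReal.ofReal_mul hr0.le, ← ENNReal.ofReal_mul (by positivity),
                ← ENNReal.ofReal_add (by positivity) (by positivity)]
              refine ENNReal.ofReal_le_ofReal ?_
              set x := ‖deriv Φ (circleMap p r θ)‖
              have : η / (4 * Real.pi) + Real.pi * r / η * (r * x ^ 2) - r * x =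
                (η - 2 * Real.pi * (r * x)) ^ 2 / (4 * Real.pi * η) := by
                field_simp
                ring
              have h0 : 0 ≤ (η - 2 * Real.pi * (r * x)) ^ 2 / (4 * Real.pi * η) := by positivity
              linarith
            · simp [indicator_of_notMem hθ]
        _ = _ := by
            rw [MeasureTheory.lintegral_add_left measurable_const,
              MeasureTheory.lintegral_const_mul' _ _ ENNReal.ofReal_ne_top]
            congr 1
            simp only [MeasureTheory.lintegral_const, MeasurableSet.univ,
              MeasureTheory.Measure.restrict_apply, univ_inter, Real.volume_Ioo]
            rw [← ENNReal.ofReal_mul (by positivity)]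
            congr 1
            field_simp
            ring
    have h3 := (hL r hr).trans hle
    have h4 : ENNReal.ofReal η = ENNReal.ofReal (η / 2) + ENNReal.ofReal (η / 2) := by
      rw [← ENNReal.ofReal_add (by positivity) (by positivity)]; congr 1; ring
    rw [h4] at h3
    have h5 := (ENNReal.add_le_add_iff_left ENNReal.ofReal_ne_top).1 h3
    have h6 : ENNReal.ofReal (η / (Real.pi * r)) * ENNReal.ofReal (η / 2) ≤
       ENNReal.ofReal (η / (Real.pi * r)) * (ENNReal.ofReal (Real.pi * r / η) * B) := by gcongr
    rw [← mul_assoc, ← ENNReal.ofReal_mul (by positivity), ← ENNReal.ofReal_mul (by positivity)] at h6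
    have e1 : η / (Real.pi * r) * (Real.pi * r / η) = 1 := by field_simp
    have e2 : η / (Real.pi * r) * (η / 2) = η ^ 2 / (2 * Real.pi) * r⁻¹ := by field_simp
    rw [e1, e2] at h6
    simpa using h6
  have hintegral : ∫⁻ r in Ioo ρ₁ ρ₂, ENNReal.ofReal (η ^ 2 / (2 * Real.pi) * r⁻¹) =
      ENNReal.ofReal (η ^ 2 / (2 * Real.pi) * Real.log (ρ₂ / ρ₁)) := by
    have hInt : IntervalIntegrable (fun r : ℝ => η ^ 2 / (2 * Real.pi) * r⁻¹)
        MeasureTheory.volume ρ₁ ρ₂ := by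
      refine (ContinuousOn.mul continuousOn_const (continuousOn_id.inv₀ ?_)).intervalIntegrable
      intro x hx
      rw [uIcc_of_le h2.le] at hx
      exact (h1.trans_le hx.1).ne'
    rw [← integral_inv_of_pos h1 (h1.trans h2), ← intervalIntegral.integral_const_mul,
      intervalIntegral.integral_of_le h2.le, MeasureTheory.ofReal_integral_eq_lintegral_ofReal]
    · exact MeasureTheory.setLIntegral_congr MeasureTheory.Ioo_ae_eq_Ioc
    · exact (intervalIntegrable_iff_integrableOn_Ioc_of_le h2.le).1 hInt
    · refine (MeasureTheory.ae_restrict_iff' measurableSet_Ioc).2 (Eventually.of_forall ?_)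
      intro x hx
      have : 0 < x := h1.trans hx.1
      positivity
  have := calc ENNReal.ofReal (η ^ 2 / (2 * Real.pi) * Real.log (ρ₂ / ρ₁))
      = ∫⁻ r in Ioo ρ₁ ρ₂, ENNReal.ofReal (η ^ 2 / (2 * Real.pi) * r⁻¹) := hintegral.symm
    _ ≤ ∫⁻ r in Ioo ρ₁ ρ₂, ∫⁻ θ in Ioo (-Real.pi) Real.pi, ENNReal.ofReal r *
        Ω.indicator (fun z => ENNReal.ofReal (‖deriv Φ z‖ ^ 2)) (circleMap p r θ) :=
        MeasureTheory.setLIntegral_mono' measurableSet_Ioo hpt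
    _ ≤ ∫⁻ r in Ioi (0:ℝ), ∫⁻ θ in Ioo (-Real.pi) Real.pi, ENNReal.ofReal r *
        Ω.indicator (fun z => ENNReal.ofReal (‖deriv Φ z‖ ^ 2)) (circleMap p r θ) :=
        MeasureTheory.lintegral_mono_set fun r hr => h1.trans hr.1
    _ = MeasureTheory.volume (Φ '' Ω) := circLen_area hΩ hΦ hi p
    _ ≤ ENNReal.ofReal A := hA
  exact (ENNReal.ofReal_le_ofReal_iff hA0).1 this

/-- Wolff's lemma. -/
theorem circLen_small {A η ρ : ℝ} (hA0 : 0 ≤ A) (hη : 0 < η) (hρ : 0 < ρ) :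
    ∃ ε > 0, ε < ρ ∧ ∀ (Φ : ℂ → ℂ) (Ω : Set ℂ), IsOpen Ω → DifferentiableOn ℂ Φ Ω →
      InjOn Φ Ω → MeasureTheory.volume (Φ '' Ω) ≤ ENNReal.ofReal A → ∀ p : ℂ,
      ∃ r ∈ Ioo ε ρ, circLen Φ Ω p r < ENNReal.ofReal η := by
  have hpi := Real.pi_pos
  set T := (A + 1) * (2 * Real.pi) / η ^ 2 with hT
  have hT0 : 0 < T := by positivity
  have hlt : ρ * Real.exp (-T) < ρ := by
    have : Real.exp (-T) < 1 := by
      rw [← Real.exp_zero]; exact Real.exp_lt_exp.2 (by linarith)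
    nlinarith
  refine ⟨ρ * Real.exp (-T), by positivity, hlt, ?_⟩
  intro Φ Ω hΩ hΦ hi hA p
  by_contra! hcon
  have := circLen_log hΩ hΦ hi p hA0 hA (by positivity) hlt hη hcon
  have e : ρ / (ρ * Real.exp (-T)) = Real.exp T := by
    rw [Real.exp_neg]; field_simp
  rw [e, Real.log_exp, hT] at this
  have e2 : η ^ 2 / (2 * Real.pi) * ((A + 1) * (2 * Real.pi) / η ^ 2) = A + 1 := by field_simp
  linarith

/-- Planar lemma: a connected set in the disk, cut off from the centre by a set with small
projections, has small horizontal width. -/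
theorem width_small {D : ℂ → ℝ} (hD : ContinuousOn D (ball (0:ℂ) 1)) {r c η : ℝ}
    (hη : 0 < η) (hη1 : η ≤ 1) (hηc : η < c)
    (hc : ∀ z ∈ ball (0:ℂ) 1, ‖z‖ < c → r < D z)
    (hP : MeasureTheory.volume (Complex.re '' {z | z ∈ ball (0:ℂ) 1 ∧ D z = r}) ≤ ENNReal.ofReal η)
    (hQ : MeasureTheory.volume (Complex.im '' {z | z ∈ ball (0:ℂ) 1 ∧ D z = r}) ≤ ENNReal.ofReal η)
    {F : Set ℂ} (hF : IsPreconnected F) (hF1 : F ⊆ ball (0:ℂ) 1) (hFD : ∀ z ∈ F, D z < r)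
    {z w : ℂ} (hz : z ∈ F) (hw : w ∈ F) : |z.re - w.re| ≤ 2 * η := by
  -- a chord which avoids the level set stays on one side
  have chord : ∀ C : Set ℂ, Convex ℝ C → C ⊆ ball (0:ℂ) 1 → (∀ z ∈ C, D z ≠ r) →
      ∀ z ∈ C, D z < r → ∀ w ∈ C, D w < r := by
    intro C hC hCb hne z hz hzr w hw
    by_contra! hcon
    have := hC.isPreconnected.intermediate_value hz hw (hD.mono hCb) ⟨hzr.le, hcon⟩
    obtain ⟨u, hu, hur⟩ := this
    exact hne u hu hur
  have hre : ∀ x : ℝ, Convex ℝ {z : ℂ | z.re = x} := fun x =>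
    convex_hyperplane (f := Complex.re) (Complex.reLm.isLinear) x
  have him : ∀ x : ℝ, Convex ℝ {z : ℂ | z.im = x} := fun x =>
    convex_hyperplane (f := Complex.im) (Complex.imLm.isLinear) x
  have hball : Convex ℝ (ball (0:ℂ) 1) := convex_ball _ _
  set P := Complex.re '' {z | z ∈ ball (0:ℂ) 1 ∧ D z = r} with hPdef
  set Q := Complex.im '' {z | z ∈ ball (0:ℂ) 1 ∧ D z = r} with hQdef
  have nsq : ∀ z : ℂ, ‖z‖ ^ 2 = z.re ^ 2 + z.im ^ 2 := by
    intro z; rw [← Complex.normSq_eq_norm_sq, Complex.normSq_apply]; ring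
  have key : Complex.re '' F ⊆ P ∪ (Icc (-1) (-1 + η / 4) ∪ Icc (1 - η / 4) 1) := by
    rintro _ ⟨e, he, rfl⟩
    by_cases hx : e.re ∈ P
    · exact Or.inl hx
    right
    have heb : ‖e‖ < 1 := by simpa using hF1 he
    have hex : e.re ^ 2 < 1 := by
      have := nsq e
      nlinarith [sq_nonneg e.im, norm_nonneg e]
    have hvert : ∀ z : ℂ, z.re = e.re → ‖z‖ < 1 → D z < r := by
      intro z hz hz1
      refine chord ({z : ℂ | z.re = e.re} ∩ ball 0 1) ((hre _).inter hball) inter_subset_right ?_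
        e ⟨rfl, hF1 he⟩ (hFD e he) z ⟨hz, by simpa using hz1⟩
      intro u hu hur
      exact hx ⟨u, ⟨hu.2, hur⟩, hu.1⟩
    set m := min (Real.sqrt (1 - e.re ^ 2)) c with hm
    have hQm : Ioo (-m) m ⊆ Q := by
      intro y hy
      by_contra hyQ
      have hym : |y| < m := abs_lt.2 hy
      have hy1 : |y| < Real.sqrt (1 - e.re ^ 2) := hym.trans_le (min_le_left _ _)
      have hy2 : |y| < c := hym.trans_le (min_le_right _ _)
      have hy3 : y ^ 2 < 1 - e.re ^ 2 := by
        rw [← sq_abs]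
        exact (Real.lt_sqrt (abs_nonneg y)).1 hy1
      have hb : ‖(⟨e.re, y⟩ : ℂ)‖ < 1 := by
        have h := nsq ⟨e.re, y⟩
        simp only at h
        nlinarith [norm_nonneg (⟨e.re, y⟩ : ℂ)]
      have hb2 : ‖(⟨0, y⟩ : ℂ)‖ = |y| := by
        have h := nsq ⟨0, y⟩
        simp only at h
        rw [← abs_of_nonneg (norm_nonneg (⟨0, y⟩ : ℂ))]
        exact (sq_eq_sq_iff_abs_eq_abs _ _).1 (by linarith)
      have hb3 : ‖(⟨0, y⟩ : ℂ)‖ < 1 := by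
        rw [hb2]; apply abs_lt_of_sq_lt_sq _ (by norm_num) ; nlinarith [sq_nonneg e.re]
      have h1 := hvert ⟨e.re, y⟩ rfl hb
      have h2 : D (⟨0, y⟩ : ℂ) < r := by
        refine chord ({z : ℂ | z.im = y} ∩ ball 0 1) ((him _).inter hball) inter_subset_right ?_
          ⟨e.re, y⟩ ⟨rfl, by simpa using hb⟩ h1 ⟨0, y⟩ ⟨rfl, by simpa using hb3⟩
        intro u hu hur
        exact hyQ ⟨u, ⟨hu.2, hur⟩, hu.1⟩
      have h3 := hc ⟨0, y⟩ (by simpa using hb3) (by rw [hb2]; exact hy2)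
      linarith
    have hm2 : 2 * m ≤ η := by
      have := (MeasureTheory.measure_mono hQm).trans hQ
      rw [Real.volume_Ioo] at this
      have := (ENNReal.ofReal_le_ofReal_iff hη.le).1 this
      linarith
    have hs : Real.sqrt (1 - e.re ^ 2) ≤ η / 2 := by
      by_contra! h
      have : η / 2 < m := lt_min h (by linarith)
      linarith
    have hs2 : 1 - e.re ^ 2 ≤ (η / 2) ^ 2 := (Real.sqrt_le_left (by linarith)).1 hs
    have hs3 : 1 - e.re ^ 2 ≤ η / 4 := by nlinarith
    have hx1 : e.re ≤ 1 := by nlinarith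
    have hx2 : -1 ≤ e.re := by nlinarith
    rcases le_total 0 e.re with h0 | h0
    · right; constructor <;> nlinarith
    · left; constructor <;> nlinarith
  have hvol : MeasureTheory.volume (Complex.re '' F) ≤ ENNReal.ofReal (2 * η) := by
    calc _ ≤ _ := MeasureTheory.measure_mono key
      _ ≤ MeasureTheory.volume P + (MeasureTheory.volume (Icc (-1:ℝ) (-1 + η / 4)) +
          MeasureTheory.volume (Icc (1 - η / 4) (1:ℝ))) :=
          (MeasureTheory.measure_union_le _ _).trans
            (add_le_add le_rfl (MeasureTheory.measure_union_le _ _))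
      _ ≤ ENNReal.ofReal η + (ENNReal.ofReal (η / 4) + ENNReal.ofReal (η / 4)) := by
          gcongr
          · rw [Real.volume_Icc]; apply ENNReal.ofReal_le_ofReal; linarith
          · rw [Real.volume_Icc]; apply ENNReal.ofReal_le_ofReal; linarith
      _ ≤ _ := by
          rw [← ENNReal.ofReal_add (by positivity) (by positivity),
            ← ENNReal.ofReal_add (by positivity) (by positivity)]
          apply ENNReal.ofReal_le_ofReal; linarith
  have hpre : IsPreconnected (Complex.re '' F) := hF.image _ Complex.continuous_re.continuousOn
  have aux : ∀ z ∈ F, ∀ w ∈ F, z.re - w.re ≤ 2 * η := by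
    intro z hz w hw
    have hsub : Icc w.re z.re ⊆ Complex.re '' F := hpre.Icc_subset ⟨w, hw, rfl⟩ ⟨z, hz, rfl⟩
    have := (MeasureTheory.measure_mono hsub).trans hvol
    rw [Real.volume_Icc] at this
    exact (ENNReal.ofReal_le_ofReal_iff (by positivity)).1 this
  rw [abs_le]
  constructor
  · linarith [aux w hw z hz]
  · exact aux z hz w hw

theorem dist_small {D : ℂ → ℝ} (hD : ContinuousOn D (ball (0:ℂ) 1)) {r c η : ℝ}
    (hη : 0 < η) (hη1 : η ≤ 1) (hηc : η < c)
    (hc : ∀ z ∈ ball (0:ℂ) 1, ‖z‖ < c → r < D z)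
    (hP : MeasureTheory.volume (Complex.re '' {z | z ∈ ball (0:ℂ) 1 ∧ D z = r}) ≤ ENNReal.ofReal η)
    (hQ : MeasureTheory.volume (Complex.im '' {z | z ∈ ball (0:ℂ) 1 ∧ D z = r}) ≤ ENNReal.ofReal η)
    {F : Set ℂ} (hF : IsPreconnected F) (hF1 : F ⊆ ball (0:ℂ) 1) (hFD : ∀ z ∈ F, D z < r)
    {z w : ℂ} (hz : z ∈ F) (hw : w ∈ F) : dist z w ≤ 4 * η := by
  have h1 := width_small hD hη hη1 hηc hc hP hQ hF hF1 hFD hz hw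
  let σ : ℂ → ℂ := fun z => ⟨z.im, z.re⟩
  have hσσ : ∀ z, σ (σ z) = z := fun z => rfl
  have hσn : ∀ z, ‖σ z‖ = ‖z‖ := by
    intro z
    simp only [Complex.norm_def, Complex.normSq_apply, σ]
    rw [add_comm]
  have hσc : Continuous σ := by
    have : σ = fun z => (z.im : ℂ) + z.re * Complex.I := by
      funext z; apply Complex.ext <;> simp [σ]
    rw [this]; fun_prop
  have hσb : ∀ z, σ z ∈ ball (0:ℂ) 1 ↔ z ∈ ball (0:ℂ) 1 := by
    intro z; simp [hσn]
  have h2 := width_small (D := fun z => D (σ z)) (F := σ '' F) (z := σ z) (w := σ w)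
    (hD.comp hσc.continuousOn fun z hz => (hσb z).2 hz) hη hη1 hηc
    (fun z hz hzc => hc _ ((hσb z).2 hz) (by rwa [hσn]))
    (by
      refine le_trans (MeasureTheory.measure_mono ?_) hQ
      rintro _ ⟨u, ⟨hu, hur⟩, rfl⟩
      exact ⟨σ u, ⟨(hσb u).2 hu, hur⟩, rfl⟩)
    (by
      refine le_trans (MeasureTheory.measure_mono ?_) hP
      rintro _ ⟨u, ⟨hu, hur⟩, rfl⟩
      exact ⟨σ u, ⟨(hσb u).2 hu, hur⟩, rfl⟩)
    (hF.image _ hσc.continuousOn)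
    (by rintro _ ⟨u, hu, rfl⟩; exact (hσb u).2 (hF1 hu))
    (by rintro _ ⟨u, hu, rfl⟩; exact hFD u hu)
    ⟨z, hz, rfl⟩ ⟨w, hw, rfl⟩
  have h3 := Complex.norm_le_abs_re_add_abs_im (z - w)
  simp only [Complex.sub_re, Complex.sub_im] at h3
  rw [dist_eq_norm]
  simp only [σ] at h2
  linarith

/-- Open mapping property of an injective holomorphic map. -/
theorem inj_open {U : Set ℂ} (hUo : IsOpen U) {φ : ℂ → ℂ} (hφd : DifferentiableOn ℂ φ U)
    (hφi : InjOn φ U) {z : ℂ} (hz : z ∈ U) {N : Set ℂ} (hN : N ∈ 𝓝 z) : φ '' (N ∩ U) ∈ 𝓝 (φ z) := by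
  have han : AnalyticAt ℂ φ z := (hφd.analyticOnNhd hUo) z hz
  rcases han.eventually_constant_or_nhds_le_map_nhds with h | h
  · exfalso
    have h' := h.and (hUo.mem_nhds hz)
    have hs : {w | φ w = φ z ∧ w ∈ U} ⊆ {z} := fun w hw => hφi hw.2 hz hw.1
    have := mem_of_superset h' hs
    exact not_isOpen_singleton z (isOpen_singleton_iff_nhds_eq_pure z |>.2
      (le_antisymm (by rw [le_pure_iff]; exact this) (pure_le_nhds z)))
  · exact h (image_mem_map (inter_mem hN (hUo.mem_nhds hz)))

theorem inverse_exists {U : Set ℂ} (hUo : IsOpen U) (hUc : IsPreconnected U) {φ : ℂ → ℂ}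
    (hφd : DifferentiableOn ℂ φ U) (hφi : InjOn φ U) :
    ∃ ψ : ℂ → ℂ, (∀ z ∈ U, ψ (φ z) = z) ∧ DifferentiableOn ℂ ψ (φ '' U) := by
  refine ⟨Function.invFunOn φ U, fun z hz => hφi.leftInvOn_invFunOn hz, ?_⟩
  set ψ := Function.invFunOn φ U
  have hψ : ∀ z ∈ U, ψ (φ z) = z := fun z hz => hφi.leftInvOn_invFunOn hz
  have hcont : ∀ z ∈ U, ContinuousAt ψ (φ z) := by
    intro z hz
    rw [ContinuousAt, hψ z hz]
    intro N hN
    rw [mem_map]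
    refine mem_of_superset (inj_open hUo hφd hφi hz hN) ?_
    rintro _ ⟨w, hw, rfl⟩
    simpa [hψ w hw.2] using hw.1
  have hgood : ∀ z ∈ U, deriv φ z ≠ 0 → DifferentiableAt ℂ ψ (φ z) := by
    intro z hz hne
    have h1 : HasDerivAt φ (deriv φ z) (ψ (φ z)) := by
      rw [hψ z hz]; exact (hφd.differentiableAt (hUo.mem_nhds hz)).hasDerivAt
    refine (h1.of_local_left_inverse (hcont z hz) hne ?_).differentiableAt
    have := inj_open hUo hφd hφi hz (univ_mem)
    filter_upwards [this]
    rintro _ ⟨w, hw, rfl⟩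
    rw [hψ w hw.2]
  rintro _ ⟨z, hz, rfl⟩
  refine DifferentiableAt.differentiableWithinAt ?_
  have han : AnalyticAt ℂ (deriv φ) z := ((hφd.analyticOnNhd hUo) z hz).deriv
  rcases han.eventually_eq_zero_or_eventually_ne_zero with h | h
  · exfalso
    -- then φ is constant near z
    obtain ⟨ε, hε, hb⟩ := Metric.mem_nhds_iff.1 (h.and (hUo.mem_nhds hz))
    have hcst : ∀ w ∈ ball z ε, φ w = φ z := by
      intro w hw
      exact isOpen_ball.is_const_of_deriv_eq_zero (convex_ball z ε).isPreconnected
        (hφd.mono fun u hu => (hb hu).2) (fun u hu => (hb hu).1) hw (mem_ball_self hε)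
    have hw : z + (ε / 2 : ℝ) ∈ ball z ε := by
      simp [abs_of_pos hε]
      exact hε
    have := hφi (hb hw).2 hz (hcst _ hw)
    simp [hε.ne'] at this
  · rw [eventually_nhdsWithin_iff] at h
    have hN := inj_open hUo hφd hφi hz h
    refine ((Complex.differentiableOn_compl_singleton_and_continuousAt_iff hN).1
      ⟨?_, hcont z hz⟩).differentiableAt hN
    rintro _ ⟨⟨w, hw, rfl⟩, hne⟩
    refine (hgood w hw.2 (hw.1 ?_)).differentiableWithinAt
    rintro rfl
    exact hne rfl

/-- Key estimate: connected sets near the frontier of small diameter have images of small diameter -/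
theorem key_estimate {U : Set ℂ} (hUo : IsOpen U) (hUc : IsPreconnected U) {φ : ℂ → ℂ}
    (hφd : DifferentiableOn ℂ φ U) (hφi : InjOn φ U) (hφs : φ '' U = ball (0 : ℂ) 1)
    {δ : ℝ} (hδ : 0 < δ) :
    ∃ ε > 0, ∀ a ∉ U, ∀ E ⊆ U, IsPreconnected E → E ⊆ ball a ε →
      ∀ z ∈ E, ∀ w ∈ E, dist (φ z) (φ w) ≤ δ := by
  obtain ⟨ψ, hψ, hψd⟩ := inverse_exists hUo hUc hφd hφi
  rw [hφs] at hψd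
  have hψU : ∀ z ∈ ball (0:ℂ) 1, ψ z ∈ U ∧ φ (ψ z) = z := by
    intro z hz
    rw [← hφs] at hz
    obtain ⟨w, hw, rfl⟩ := hz
    rw [hψ w hw]; exact ⟨hw, rfl⟩
  have h0 : (0:ℂ) ∈ φ '' U := by rw [hφs]; simp
  obtain ⟨w0, hw0, hw00⟩ := h0
  obtain ⟨ρ', hρ', hρU⟩ := Metric.isOpen_iff.1 hUo w0 hw0
  set ρ := ρ' / 2 with hρdef
  have hρ : 0 < ρ := by positivity
  have hnb := inj_open hUo hφd hφi hw0 (ball_mem_nhds w0 hρ)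
  rw [hw00] at hnb
  obtain ⟨c, hc, hcb⟩ := Metric.mem_nhds_iff.1 hnb
  set η := min (min 1 (c / 2)) (δ / 4) with hη
  have hη0 : 0 < η := by positivity
  have hη1 : η ≤ 1 := (min_le_left _ _).trans (min_le_left _ _)
  have hηc : η < c := ((min_le_left _ _).trans (min_le_right _ _)).trans_lt (by linarith)
  have hηδ : 4 * η ≤ δ := by
    have : η ≤ δ / 4 := min_le_right _ _
    linarith
  obtain ⟨ε, hε, hερ, hsm⟩ := circLen_small (A := Real.pi) Real.pi_pos.le hη0 hρ
  refine ⟨ε, hε, ?_⟩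
  intro a ha E hEU hE hEb z hz w hw
  obtain ⟨r, hr, hrL⟩ := hsm φ U hUo hφd hφi (by
    rw [hφs, Complex.volume_ball]
    simp [ENNReal.ofReal, NNReal.pi, Real.toNNReal_of_nonneg Real.pi_pos.le]
    exact le_rfl) a
  have hr0 : 0 < r := hε.trans hr.1
  have hdist : ρ' ≤ dist w0 a := by
    by_contra! h
    exact ha (hρU (by rwa [mem_ball, dist_comm]))
  have proj : ∀ g : ℂ →L[ℝ] ℝ, ‖g‖ ≤ 1 →
      MeasureTheory.volume (g '' {z | z ∈ ball (0:ℂ) 1 ∧ dist (ψ z) a = r}) ≤ ENNReal.ofReal η := by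
    intro g hg
    have := circLen_image hUo hφd (g := g) (M := 1) zero_le_one
      (fun z hz => ⟨g, g.hasFDerivAt, hg⟩) a hr0
    rw [ENNReal.ofReal_one, one_mul] at this
    refine le_trans (MeasureTheory.measure_mono ?_) (this.trans hrL.le)
    rintro _ ⟨u, ⟨hu, hur⟩, rfl⟩
    refine ⟨ψ u, ⟨hur, (hψU u hu).1⟩, ?_⟩
    simp only [(hψU u hu).2]
  refine le_trans (dist_small (D := fun z => dist (ψ z) a) (r := r) (c := c) (F := φ '' E)
    ((continuous_id.dist continuous_const).comp_continuousOn hψd.continuousOn) hη0 hη1 hηc ?_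
    (proj Complex.reCLM (by simp)) (proj Complex.imCLM (by simp))
    (hE.image _ (hφd.continuousOn.mono hEU)) ?_ ?_ ⟨z, hz, rfl⟩ ⟨w, hw, rfl⟩) hηδ
  · intro u hu huc
    obtain ⟨v, ⟨hv, hvU⟩, rfl⟩ := hcb (show u ∈ ball 0 c by simpa using huc)
    simp only [hψ v hvU]
    have := dist_triangle w0 v a
    have h2 : dist w0 v < ρ := by rw [dist_comm]; exact hv
    linarith [hr.2]
  · rw [← hφs]; exact image_mono hEU
  · rintro _ ⟨u, hu, rfl⟩
    simp only [hψ u (hEU hu)]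
    exact lt_trans (hEb hu) hr.1

theorem end_limit {U : Set ℂ} (hUo : IsOpen U) (hUc : IsPreconnected U) {φ : ℂ → ℂ}
    (hφd : DifferentiableOn ℂ φ U) (hφi : InjOn φ U) (hφs : φ '' U = ball (0 : ℂ) 1)
    {f : ℝ → ℂ} (hf : Continuous f) (hf0 : f 0 ∉ U) (hfU : ∀ t ∈ Ioo (0:ℝ) 1, f t ∈ U) :
    ∃ ζ : ℂ, ‖ζ‖ = 1 ∧ Tendsto (fun t => φ (f t)) (𝓝[>] 0) (𝓝 ζ) := by
  obtain ⟨ψ, hψ, hψd⟩ := inverse_exists hUo hUc hφd hφi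
  have hIoo : Ioo (0:ℝ) 1 ∈ 𝓝[>] (0:ℝ) := Ioo_mem_nhdsGT one_pos
  have hC : Cauchy (map (fun t => φ (f t)) (𝓝[>] 0)) := by
    rw [Metric.cauchy_iff]
    refine ⟨inferInstance, fun δ hδ => ?_⟩
    obtain ⟨ε, hε, hkey⟩ := key_estimate hUo hUc hφd hφi hφs (half_pos hδ)
    have hb : f ⁻¹' ball (f 0) ε ∈ 𝓝[>] (0:ℝ) :=
      mem_nhdsWithin_of_mem_nhds (hf.continuousAt (ball_mem_nhds _ hε))
    obtain ⟨τ, hτ, hτs⟩ := (mem_nhdsGT_iff_exists_Ioo_subset).1 (inter_mem hb hIoo)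
    refine ⟨(fun t => φ (f t)) '' Ioo 0 τ, image_mem_map (Ioo_mem_nhdsGT hτ), ?_⟩
    rintro _ ⟨s, hs, rfl⟩ _ ⟨t, ht, rfl⟩
    refine lt_of_le_of_lt (hkey (f 0) hf0 (f '' Ioo 0 τ) ?_ ?_ ?_ _ ⟨s, hs, rfl⟩ _ ⟨t, ht, rfl⟩)
      (half_lt_self hδ)
    · rintro _ ⟨u, hu, rfl⟩; exact hfU u (hτs hu).2
    · exact isPreconnected_Ioo.image _ hf.continuousOn
    · rintro _ ⟨u, hu, rfl⟩; exact (hτs hu).1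
  obtain ⟨ζ, hζ⟩ := cauchy_iff_exists_le_nhds.1 hC
  have hT : Tendsto (fun t => φ (f t)) (𝓝[>] 0) (𝓝 ζ) := hζ
  refine ⟨ζ, ?_, hT⟩
  have hle : ζ ∈ closedBall (0:ℂ) 1 := by
    refine isClosed_closedBall.mem_of_tendsto hT ?_
    filter_upwards [hIoo] with t ht
    apply ball_subset_closedBall
    rw [← hφs]; exact ⟨_, hfU t ht, rfl⟩
  rcases (show ‖ζ‖ ≤ 1 by simpa using hle).lt_or_eq with hlt | heq
  · exfalso
    have hζ : ζ ∈ φ '' U := by rw [hφs]; simpa using hlt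
    have hop : φ '' U ∈ 𝓝 ζ := by rw [hφs] at hζ ⊢; exact isOpen_ball.mem_nhds hζ
    have h1 : Tendsto (fun t => ψ (φ (f t))) (𝓝[>] 0) (𝓝 (ψ ζ)) :=
      ((hψd.differentiableAt hop).continuousAt.tendsto).comp hT
    have h2 : Tendsto (fun t => ψ (φ (f t))) (𝓝[>] 0) (𝓝 (f 0)) := by
      refine (hf.continuousAt.mono_left nhdsWithin_le_nhds : Tendsto f (𝓝[>] 0) (𝓝 (f 0))).congr' ?_
      filter_upwards [hIoo] with t ht
      rw [hψ _ (hfU t ht)]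
    obtain ⟨u, hu, hu'⟩ := hζ
    have := tendsto_nhds_unique h1 h2
    rw [← hu', hψ u hu] at this
    exact hf0 (this ▸ hu)
  · exact heq

theorem arc_preconnected {ζ : ℂ} (hζ : ‖ζ‖ = 1) {r : ℝ} (hr : 0 < r) :
    IsPreconnected (sphere ζ r ∩ ball (0:ℂ) 1) := by
  have hζ0 : ζ ≠ 0 := by rintro rfl; simp at hζ
  set S : Set ℝ := {x | x ∈ Icc (-Real.pi) Real.pi ∧ r / 2 < Real.cos x} with hS
  have hSo : OrdConnected S := by
    constructor
    intro α hα β hβ x hx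
    refine ⟨⟨hα.1.1.trans hx.1, hx.2.trans hβ.1.2⟩, ?_⟩
    rcases le_total 0 x with h | h
    · exact hβ.2.trans_le (Real.cos_le_cos_of_nonneg_of_le_pi h hβ.1.2 hx.2)
    · have := Real.cos_le_cos_of_nonneg_of_le_pi (x := -x) (y := -α) (by linarith)
        (by linarith [hα.1.1]) (by linarith [hx.1])
      rw [Real.cos_neg, Real.cos_neg] at this
      exact hα.2.trans_le this
  have hnorm : ∀ x : ℝ, ‖ζ * (1 - r * Complex.exp (x * Complex.I))‖ ^ 2 =
      1 - 2 * r * Real.cos x + r ^ 2 := by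
    intro x
    rw [norm_mul, hζ, one_mul, ← Complex.normSq_eq_norm_sq, Complex.normSq_apply]
    simp only [Complex.sub_re, Complex.one_re, Complex.mul_re, Complex.ofReal_re,
      Complex.exp_ofReal_mul_I_re, Complex.ofReal_im, Complex.exp_ofReal_mul_I_im, Complex.sub_im,
      Complex.one_im, Complex.mul_im]
    nlinarith [Real.sin_sq_add_cos_sq x]
  have himg : sphere ζ r ∩ ball (0:ℂ) 1 =
      (fun x : ℝ => ζ * (1 - r * Complex.exp (x * Complex.I))) '' S := by
    ext z
    constructor
    · rintro ⟨hz, hzb⟩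
      have hz1 : ‖1 - z / ζ‖ = r := by
        have : 1 - z / ζ = (ζ - z) / ζ := by field_simp
        rw [this, norm_div, hζ, div_one, norm_sub_rev]
        simpa [dist_eq_norm] using hz
      have hz2 := Complex.norm_mul_exp_arg_mul_I (1 - z / ζ)
      rw [hz1] at hz2
      have hz3 : ζ * (1 - r * Complex.exp (Complex.arg (1 - z / ζ) * Complex.I)) = z := by
        rw [hz2]; field_simp; ring
      refine ⟨Complex.arg (1 - z / ζ), ⟨⟨(Complex.neg_pi_lt_arg _).le, Complex.arg_le_pi _⟩, ?_⟩, hz3⟩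
      have h := hnorm (Complex.arg (1 - z / ζ))
      rw [hz3] at h
      have hzl : ‖z‖ < 1 := by simpa using hzb
      nlinarith [norm_nonneg z]
    · rintro ⟨x, hx, rfl⟩
      have h := hnorm x
      constructor
      · simp only [mem_sphere, dist_eq_norm]
        have : ζ * (1 - r * Complex.exp (x * Complex.I)) - ζ = -(ζ * (r * Complex.exp (x * Complex.I))) := by
          ring
        rw [this, norm_neg, norm_mul, hζ, norm_mul, Complex.norm_exp_ofReal_mul_I]
        simp [abs_of_pos hr]
      · simp only [mem_ball, dist_zero_right]
        have h2 := hx.2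
        have : ‖ζ * (1 - r * Complex.exp (x * Complex.I))‖ ^ 2 < 1 := by rw [h]; nlinarith
        nlinarith [norm_nonneg (ζ * (1 - r * Complex.exp (x * Complex.I)))]
  rw [himg]
  exact hSo.isPreconnected.image _ (by fun_prop)

theorem hits_circle {γ : ℝ → ℂ} (hγ : ContinuousOn γ (Ioo 0 1)) {ζ : ℂ}
    (hT : Tendsto γ (𝓝[>] 0) (𝓝 ζ)) {τ r : ℝ} (hτ : τ ∈ Ioo (0:ℝ) 1) (hr : 0 < r)
    (hrτ : r < dist (γ τ) ζ) : ∃ t ∈ Ioc 0 τ, dist (γ t) ζ = r := by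
  have h1 : γ ⁻¹' ball ζ r ∈ 𝓝[>] (0:ℝ) := hT (ball_mem_nhds ζ hr)
  obtain ⟨s, hs, hsr⟩ := Filter.nonempty_of_mem (inter_mem (Ioo_mem_nhdsGT hτ.1) h1)
  have hsub : Icc s τ ⊆ Ioo 0 1 := fun x hx => ⟨hs.1.trans_le hx.1, hx.2.trans_lt hτ.2⟩
  have hc : ContinuousOn (fun t => dist (γ t) ζ) (Icc s τ) :=
    (continuous_id.dist continuous_const).comp_continuousOn (hγ.mono hsub)
  obtain ⟨t, ht, htr⟩ := intermediate_value_Icc hs.2.le hc ⟨le_of_lt hsr, hrτ.le⟩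
  exact ⟨t, ⟨hs.1.trans_le ht.1, ht.2⟩, htr⟩

theorem ends_distinct {U : Set ℂ} (hUo : IsOpen U) (hUc : IsPreconnected U) {φ : ℂ → ℂ}
    (hφd : DifferentiableOn ℂ φ U) (hφi : InjOn φ U) (hφs : φ '' U = ball (0 : ℂ) 1)
    {f₁ f₂ : ℝ → ℂ} (hf₁ : Continuous f₁) (hf₂ : Continuous f₂)
    (hU₁ : ∀ t ∈ Ioo (0:ℝ) 1, f₁ t ∈ U) (hU₂ : ∀ t ∈ Ioo (0:ℝ) 1, f₂ t ∈ U)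
    (hne : f₁ 0 ≠ f₂ 0) {ζ : ℂ} (hζ : ‖ζ‖ = 1)
    (hT₁ : Tendsto (fun t => φ (f₁ t)) (𝓝[>] 0) (𝓝 ζ))
    (hT₂ : Tendsto (fun t => φ (f₂ t)) (𝓝[>] 0) (𝓝 ζ)) : False := by
  obtain ⟨ψ, hψ, hψd⟩ := inverse_exists hUo hUc hφd hφi
  rw [hφs] at hψd
  have hmem : ∀ u ∈ U, φ u ∈ ball (0:ℂ) 1 := fun u hu => by rw [← hφs]; exact ⟨u, hu, rfl⟩
  have hψi : InjOn ψ (ball 0 1) := by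
    intro x hx y hy hxy
    rw [← hφs] at hx hy
    obtain ⟨u, hu, rfl⟩ := hx
    obtain ⟨v, hv, rfl⟩ := hy
    rw [hψ u hu, hψ v hv] at hxy
    rw [hxy]
  set a := f₁ 0
  set b := f₂ 0
  have hd : 0 < dist a b := dist_pos.2 hne
  set R := dist a b / 2 with hR
  have hR0 : 0 < R := half_pos hd
  have pick : ∀ f : ℝ → ℂ, Continuous f → (∀ t ∈ Ioo (0:ℝ) 1, f t ∈ U) → ∀ e > 0,
      ∃ τ ∈ Ioo (0:ℝ) 1, (∀ t ∈ Ioc 0 τ, dist (f t) (f 0) < e) ∧ 0 < dist (φ (f τ)) ζ := by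
    intro f hf hfU e he
    obtain ⟨d, hd, hdb⟩ := Metric.continuousAt_iff.1 (hf.continuousAt (x := 0)) e he
    refine ⟨min (d / 2) (1 / 2), ⟨by positivity, (min_le_right _ _).trans_lt (by norm_num)⟩, ?_, ?_⟩
    · intro t ht
      apply hdb
      rw [Real.dist_eq, sub_zero, abs_of_pos ht.1]
      exact (ht.2.trans (min_le_left _ _)).trans_lt (half_lt_self hd)
    · rw [dist_pos]
      intro h
      have := hmem _ (hfU (min (d / 2) (1 / 2)) ⟨by positivity, (min_le_right _ _).trans_lt (by norm_num)⟩)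
      rw [h] at this
      simp [hζ] at this
  obtain ⟨τ₁, hτ₁, hc₁, hp₁⟩ := pick f₁ hf₁ hU₁ (R / 2) (by positivity)
  obtain ⟨τ₂, hτ₂, hc₂, hp₂⟩ := pick f₂ hf₂ hU₂ R hR0
  have cont : ∀ f : ℝ → ℂ, Continuous f → (∀ t ∈ Ioo (0:ℝ) 1, f t ∈ U) →
      ContinuousOn (fun t => φ (f t)) (Ioo 0 1) := fun f hf hfU =>
    hφd.continuousOn.comp hf.continuousOn hfU
  set Ω := ball (0:ℂ) 1 ∩ ψ ⁻¹' ball a R with hΩ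
  have hΩo : IsOpen Ω := hψd.continuousOn.isOpen_inter_preimage isOpen_ball isOpen_ball
  have hΩd : DifferentiableOn ℂ ψ Ω := hψd.mono inter_subset_left
  have hΩi : InjOn ψ Ω := hψi.mono inter_subset_left
  obtain ⟨ε, hε, hερ, hsm⟩ := circLen_small (A := R ^ 2 * Real.pi) (η := R / 4)
    (ρ := min (dist (φ (f₁ τ₁)) ζ) (dist (φ (f₂ τ₂)) ζ))
    (by positivity) (by positivity) (lt_min hp₁ hp₂)
  obtain ⟨r, hr, hrL⟩ := hsm ψ Ω hΩo hΩd hΩi (by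
    refine (MeasureTheory.measure_mono (show ψ '' Ω ⊆ ball a R by
      rintro _ ⟨u, hu, rfl⟩; exact hu.2)).trans ?_
    rw [Complex.volume_ball, ENNReal.ofReal_mul (by positivity), ENNReal.ofReal_pow hR0.le]
    gcongr
    simp [ENNReal.ofReal, NNReal.pi, Real.toNNReal_of_nonneg Real.pi_pos.le]
    exact le_rfl) ζ
  have hr0 : 0 < r := hε.trans hr.1
  obtain ⟨t₁, ht₁, hr₁⟩ := hits_circle (cont f₁ hf₁ hU₁) hT₁ hτ₁ hr0 (hr.2.trans_le (min_le_left _ _))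
  obtain ⟨t₂, ht₂, hr₂⟩ := hits_circle (cont f₂ hf₂ hU₂) hT₂ hτ₂ hr0 (hr.2.trans_le (min_le_right _ _))
  have hu₁ : f₁ t₁ ∈ U := hU₁ _ ⟨ht₁.1, ht₁.2.trans_lt hτ₁.2⟩
  have hu₂ : f₂ t₂ ∈ U := hU₂ _ ⟨ht₂.1, ht₂.2.trans_lt hτ₂.2⟩
  have hv₁ : dist (f₁ t₁) a < R / 2 := hc₁ t₁ ht₁
  have hv₂ : R < dist (f₂ t₂) a := by
    have h1 : dist (f₂ t₂) b < R := hc₂ t₂ ht₂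
    have h2 := dist_triangle a (f₂ t₂) b
    rw [dist_comm a (f₂ t₂)] at h2
    linarith
  have hcD : ContinuousOn (fun z => ‖ψ z - a‖ ^ 2) (sphere ζ r ∩ ball 0 1) :=
    (((hψd.continuousOn.mono inter_subset_right).sub continuousOn_const).norm).pow 2
  have hIVT := (arc_preconnected hζ hr0).intermediate_value
    (a := φ (f₁ t₁)) (b := φ (f₂ t₂)) ⟨hr₁, hmem _ hu₁⟩ ⟨hr₂, hmem _ hu₂⟩ hcD
  simp only [hψ _ hu₁, hψ _ hu₂, ← dist_eq_norm] at hIVT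
  have hsub : Ioo (R ^ 2 / 4) (R ^ 2) ⊆ (fun z => (fun w => ‖w - a‖ ^ 2) (ψ z)) '' (sphere ζ r ∩ Ω) := by
    intro v hv
    obtain ⟨z, hz, hzv⟩ := hIVT (show v ∈ _ from ⟨by nlinarith [hv.1, dist_nonneg (x := f₁ t₁) (y := a)], by nlinarith [hv.2]⟩)
    simp only at hzv
    refine ⟨z, ⟨hz.1, hz.2, ?_⟩, by simpa [dist_eq_norm] using hzv⟩
    simp only [mem_preimage, mem_ball]
    have := hv.2
    rw [← hzv] at this
    exact lt_of_pow_lt_pow_left₀ 2 hR0.le this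
  have hbd := circLen_image hΩo hΩd (g := fun w => ‖w - a‖ ^ 2) (M := 2 * R) (by positivity) (by
    intro z hz
    refine ⟨_, ((hasFDerivAt_id (𝕜 := ℝ) (ψ z)).sub_const a).norm_sq, ?_⟩
    have hz2 : ‖ψ z - a‖ < R := by simpa [dist_eq_norm] using hz.2
    refine ContinuousLinearMap.opNorm_le_bound _ (by positivity) fun v => ?_
    simp
    have := abs_real_inner_le_norm (ψ z - a) v
    simp at this
    rw [show (v.re * (ψ z).re + v.im * (ψ z).im - (v.re * a.re + v.im * a.im)) =
      v.re * ((ψ z).re - a.re) - v.im * (-(ψ z).im + a.im) by ring]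
    nlinarith [norm_nonneg v]) ζ hr0
  have h1 := (MeasureTheory.measure_mono hsub).trans hbd
  have h2 : ENNReal.ofReal (2 * R) * circLen ψ Ω ζ r ≤ ENNReal.ofReal (2 * R * (R / 4)) := by
    rw [ENNReal.ofReal_mul (show 0 ≤ 2 * R by positivity)]
    exact mul_le_mul' le_rfl hrL.le
  have h3 := h1.trans h2
  rw [Real.volume_Ioo] at h3
  have := (ENNReal.ofReal_le_ofReal_iff (by positivity)).1 h3
  nlinarith

theorem crosscut_param {U K : Set ℂ} (hUo : IsOpen U) (hK : IsCrosscut U K) :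
    ∃ F : ℝ → ℂ, Continuous F ∧ InjOn F (Icc 0 1) ∧ F '' Ioo 0 1 = K ∧ F 0 ∈ frontier U ∧
      F 1 ∈ frontier U := by
  obtain ⟨hKU, ⟨h⟩, a, b, ⟨f, hfc, hfi, hfr, hf0, hf1⟩, hab⟩ := hK
  have ha : a ∈ frontier U := by
    have : a ∈ closure K ∩ frontier U := by rw [hab]; simp
    exact this.2
  have hb : b ∈ frontier U := by
    have : b ∈ closure K ∩ frontier U := by rw [hab]; simp
    exact this.2
  have hnU : ∀ x ∈ frontier U, x ∉ U := by
    intro x hx hxU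
    rw [hUo.frontier_eq] at hx
    exact hx.2 hxU
  have hF : ∀ t (ht : t ∈ Icc (0:ℝ) 1), IccExtend zero_le_one f t = f ⟨t, ht⟩ :=
    fun t ht => IccExtend_of_mem zero_le_one f ht
  have hemb : Topology.IsClosedEmbedding f := hfc.isClosedEmbedding hfi
  have hKr : K ⊆ range f := by rw [hfr]; exact subset_closure
  have hpre : IsPreconnected K := by
    haveI : PreconnectedSpace (Ioo (0:ℝ) 1) := Subtype.preconnectedSpace isPreconnected_Ioo
    have : K = range (fun t => ((h.symm t : K) : ℂ)) := by
      ext x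
      constructor
      · intro hx
        exact ⟨h ⟨x, hx⟩, by simp⟩
      · rintro ⟨t, rfl⟩
        exact (h.symm t).2
    rw [this]
    exact isPreconnected_range (continuous_subtype_val.comp h.symm.continuous)
  have himg : f '' (f ⁻¹' K) = K := image_preimage_eq_of_subset hKr
  have hTpre : IsPreconnected (f ⁻¹' K) := by
    rw [← hemb.isInducing.isPreconnected_image, himg]; exact hpre
  have hTd : Dense (f ⁻¹' K) := by
    rw [dense_iff_closure_eq, hemb.isInducing.closure_eq_preimage_closure_image, himg, ← hfr]
    simp
  refine ⟨IccExtend zero_le_one f, hfc.Icc_extend', ?_, ?_, ?_, ?_⟩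
  · intro s hs t ht hst
    rw [hF s hs, hF t ht] at hst
    exact congrArg Subtype.val (hfi hst)
  · apply Subset.antisymm
    · rintro _ ⟨t, ht, rfl⟩
      rw [hF t (Ioo_subset_Icc_self ht)]
      set x : Icc (0:ℝ) 1 := ⟨t, Ioo_subset_Icc_self ht⟩
      obtain ⟨s₁, hs₁, hs₁K⟩ := hTd.inter_open_nonempty (Iio x) isOpen_Iio
        ⟨⟨0, by norm_num⟩, (show (0:ℝ) < t from ht.1)⟩
      obtain ⟨s₂, hs₂, hs₂K⟩ := hTd.inter_open_nonempty (Ioi x) isOpen_Ioi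
        ⟨⟨1, by norm_num⟩, (show t < (1:ℝ) from ht.2)⟩
      exact hTpre.Icc_subset hs₁K hs₂K ⟨le_of_lt hs₁, le_of_lt hs₂⟩
    · intro x hx
      obtain ⟨⟨t, ht⟩, rfl⟩ := hKr hx
      refine ⟨t, ⟨lt_of_le_of_ne ht.1 ?_, lt_of_le_of_ne ht.2 ?_⟩, hF t ht⟩
      · rintro rfl
        exact hnU a ha (hf0 ▸ hKU hx)
      · rintro rfl
        exact hnU b hb (hf1 ▸ hKU hx)
  · rw [hF 0 (by norm_num), hf0]; exact ha
  · rw [hF 1 (by norm_num), hf1]; exact hb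

theorem crosscut_image {U K : Set ℂ} (hUo : IsOpen U) (hUc : IsPreconnected U) {φ : ℂ → ℂ}
    (hφd : DifferentiableOn ℂ φ U) (hφi : InjOn φ U) (hφs : φ '' U = ball (0 : ℂ) 1)
    (hK : IsCrosscut U K) : IsCrosscut (ball (0:ℂ) 1) (φ '' K) := by
  obtain ⟨F, hFc, hFi, hFK, hF0, hF1⟩ := crosscut_param hUo hK
  obtain ⟨hKU, ⟨h⟩, -⟩ := hK
  obtain ⟨ψ, hψ, hψd⟩ := inverse_exists hUo hUc hφd hφi
  have hnU : ∀ x ∈ frontier U, x ∉ U := by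
    intro x hx hxU
    rw [hUo.frontier_eq] at hx
    exact hx.2 hxU
  have hFU : ∀ t ∈ Ioo (0:ℝ) 1, F t ∈ U := fun t ht => hKU (hFK ▸ ⟨t, ht, rfl⟩)
  have hFU' : ∀ t ∈ Ioo (0:ℝ) 1, F (1 - t) ∈ U := fun t ht =>
    hFU _ ⟨by linarith [ht.2], by linarith [ht.1]⟩
  have hFc' : Continuous fun t => F (1 - t) := hFc.comp (by fun_prop)
  obtain ⟨ζ₀, hζ₀, hT₀⟩ := end_limit hUo hUc hφd hφi hφs hFc (hnU _ hF0) hFU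
  obtain ⟨ζ₁, hζ₁, hT₁⟩ := end_limit hUo hUc hφd hφi hφs hFc'
    (by simpa using hnU _ hF1) hFU'
  have hne : ζ₀ ≠ ζ₁ := by
    rintro rfl
    refine ends_distinct hUo hUc hφd hφi hφs hFc hFc' hFU hFU' ?_ hζ₀ hT₀ hT₁
    intro h01
    have := hFi (by norm_num) (by norm_num) h01
    norm_num at this
  set γ : ℝ → ℂ := fun t => φ (F t) with hγ
  have hT₁' : Tendsto γ (𝓝[<] 1) (𝓝 ζ₁) := by
    have hs : Tendsto (fun t : ℝ => 1 - t) (𝓝[<] 1) (𝓝[>] 0) := by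
      refine tendsto_nhdsWithin_iff.2 ⟨?_, ?_⟩
      · have : Tendsto (fun t : ℝ => 1 - t) (𝓝 1) (𝓝 (1 - 1)) :=
          (continuous_const.sub continuous_id).tendsto 1
        rw [sub_self] at this
        exact this.mono_left nhdsWithin_le_nhds
      · filter_upwards [self_mem_nhdsWithin] with t ht
        have : t < 1 := ht
        simpa using this
    have := hT₁.comp hs
    refine this.congr fun t => ?_
    simp [hγ]
  have hγc : ContinuousOn γ (Ioo 0 1) := hφd.continuousOn.comp hFc.continuousOn hFU
  set G := extendFrom (Ioo (0:ℝ) 1) γ with hG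
  have hGc : ContinuousOn G (Icc 0 1) := continuousOn_Icc_extendFrom_Ioo hγc hT₀ hT₁'
  have hGγ : ∀ t ∈ Ioo (0:ℝ) 1, G t = γ t := by
    intro t ht
    exact extendFrom_eq (subset_closure ht) (hγc t ht)
  have hG0 : G 0 = ζ₀ := eq_lim_at_left_extendFrom_Ioo one_pos hT₀
  have hG1 : G 1 = ζ₁ := eq_lim_at_right_extendFrom_Ioo one_pos hT₁'
  have hball : ∀ t ∈ Ioo (0:ℝ) 1, ‖G t‖ < 1 := by
    intro t ht
    have : γ t ∈ ball (0:ℂ) 1 := by rw [← hφs]; exact ⟨_, hFU t ht, rfl⟩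
    rw [hGγ t ht]; simpa using this
  have hIoo : G '' Ioo 0 1 = φ '' K := by
    rw [← hFK, image_image]
    exact image_congr hGγ
  have hIcc : G '' Icc 0 1 = closure (φ '' K) := by
    apply Subset.antisymm
    · rw [← hIoo, ← closure_Ioo (zero_ne_one' ℝ)]
      apply ContinuousOn.image_closure
      rwa [closure_Ioo (zero_ne_one' ℝ)]
    · refine closure_minimal ?_ (isCompact_Icc.image_of_continuousOn hGc).isClosed
      rw [← hIoo]
      exact image_mono Ioo_subset_Icc_self
  have cases01 : ∀ t ∈ Icc (0:ℝ) 1, t = 0 ∨ t = 1 ∨ t ∈ Ioo (0:ℝ) 1 := fun t ht =>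
    eq_endpoints_or_mem_Ioo_of_mem_Icc ht
  have hGi : InjOn G (Icc 0 1) := by
    have hin : ∀ t ∈ Ioo (0:ℝ) 1, G t ≠ ζ₀ ∧ G t ≠ ζ₁ := by
      intro t ht
      have := hball t ht
      constructor
      · intro hh; rw [hh, hζ₀] at this; exact lt_irrefl _ this
      · intro hh; rw [hh, hζ₁] at this; exact lt_irrefl _ this
    intro s hs t ht hst
    rcases cases01 s hs with rfl | rfl | hs' <;> rcases cases01 t ht with rfl | rfl | ht'
    · rfl
    · rw [hG0, hG1] at hst; exact absurd hst hne
    · rw [hG0] at hst; exact absurd hst.symm (hin t ht').1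
    · rw [hG0, hG1] at hst; exact absurd hst.symm hne
    · rfl
    · rw [hG1] at hst; exact absurd hst.symm (hin t ht').2
    · rw [hG0] at hst; exact absurd hst (hin s hs').1
    · rw [hG1] at hst; exact absurd hst (hin s hs').2
    · rw [hGγ s hs', hGγ t ht'] at hst
      exact hFi hs ht (hφi (hFU s hs') (hFU t ht') hst)
  let e : K ≃ₜ (φ '' K) :=
    { toFun := fun x => ⟨φ x, ⟨x, x.2, rfl⟩⟩
      invFun := fun y => ⟨ψ y, by
        obtain ⟨y, x, hx, rfl⟩ := y
        simpa [hψ x (hKU hx)] using hx⟩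
      left_inv := fun x => Subtype.ext (hψ x (hKU x.2))
      right_inv := by
        rintro ⟨y, x, hx, rfl⟩
        apply Subtype.ext
        simp [hψ x (hKU hx)]
      continuous_toFun := by
        refine Continuous.subtype_mk ?_ _
        exact (continuousOn_iff_continuous_restrict.1 (hφd.continuousOn.mono hKU))
      continuous_invFun := by
        refine Continuous.subtype_mk ?_ _
        exact (continuousOn_iff_continuous_restrict.1 (hψd.continuousOn.mono (image_mono hKU))) }
  refine ⟨?_, ⟨e.symm.trans h⟩, ζ₀, ζ₁, ⟨fun t => G t, ?_, ?_, ?_, hG0, hG1⟩, ?_⟩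
  · rw [← hφs]; exact image_mono hKU
  · exact continuousOn_iff_continuous_restrict.1 hGc
  · intro s t hst
    exact Subtype.ext (hGi s.2 t.2 hst)
  · rw [← hIcc]
    ext x
    simp
  · rw [← hIcc, frontier_ball (0:ℂ) one_ne_zero]
    ext x
    constructor
    · rintro ⟨⟨t, ht, rfl⟩, hx⟩
      rcases cases01 t ht with rfl | rfl | ht'
      · simp [hG0]
      · simp [hG1]
      · have := hball t ht'
        simp only [mem_sphere, dist_zero_right] at hx
        linarith
    · rintro (rfl | rfl)
      · exact ⟨⟨0, by norm_num, hG0⟩, by simpa using hζ₀⟩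
      · exact ⟨⟨1, by norm_num, hG1⟩, by simpa using hζ₁⟩

/-- A conformal isomorphism from a simply connected domain `U ⊆ ℂ` with
nondegenerate frontier onto the unit disk maps a null sequence of crosscuts of
`U` to a null sequence of crosscuts of the unit disk. -/
theorem conformal_image_null_sequence_of_crosscuts
    (U : Set ℂ) (hUo : IsOpen U) (hUc : IsConnected U)
    (hUs : SimplyConnectedSpace U) (hfr : (frontier U).Nontrivial)
    (φ : ℂ → ℂ) (hφd : DifferentiableOn ℂ φ U) (hφi : Set.InjOn φ U)
    (hφs : φ '' U = Metric.ball (0 : ℂ) 1)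
    (K : ℕ → Set ℂ) (hK : ∀ n, IsCrosscut U (K n))
    (hnull : Tendsto (fun n => Metric.diam (K n)) atTop (𝓝 0)) :
    (∀ n, IsCrosscut (Metric.ball (0 : ℂ) 1) (φ '' K n)) ∧
      Tendsto (fun n => Metric.diam (φ '' K n)) atTop (𝓝 0) := by
  refine ⟨fun n => crosscut_image hUo hUc.isPreconnected hφd hφi hφs (hK n), ?_⟩
  rw [Metric.tendsto_atTop] at hnull ⊢
  intro δ hδ
  obtain ⟨ε, hε, hkey⟩ :=
    key_estimate hUo hUc.isPreconnected hφd hφi hφs (half_pos hδ)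
  obtain ⟨N, hN⟩ := hnull ε hε
  refine ⟨N, fun n hn => ?_⟩
  have hdn := hN n hn
  rw [Real.dist_eq, sub_zero, abs_of_nonneg Metric.diam_nonneg] at hdn ⊢
  refine lt_of_le_of_lt (Metric.diam_le_of_forall_dist_le (half_pos hδ).le ?_) (half_lt_self hδ)
  obtain ⟨F, hFc, hFi, hFK, hF0, hF1⟩ := crosscut_param hUo (hK n)
  have ha : F 0 ∉ U := by
    intro hU
    rw [hUo.frontier_eq] at hF0
    exact hF0.2 hU
  have hcl : F 0 ∈ closure (K n) := by
    have h1 : F '' closure (Ioo 0 1) ⊆ closure (F '' Ioo 0 1) :=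
      image_closure_subset_closure_image hFc
    rw [hFK, closure_Ioo (zero_ne_one' ℝ)] at h1
    exact h1 ⟨0, by norm_num, rfl⟩
  have hbd : Bornology.IsBounded (closure (K n)) := by
    rw [← hFK]
    refine ((isCompact_Icc (a := (0:ℝ)) (b := 1)).image hFc).isBounded.subset ?_
    exact closure_minimal (image_mono Ioo_subset_Icc_self)
      ((isCompact_Icc (a := (0:ℝ)) (b := 1)).image hFc).isClosed
  rintro _ ⟨z, hz, rfl⟩ _ ⟨w, hw, rfl⟩
  refine hkey (F 0) ha (K n) (hK n).1 ?_ ?_ z hz w hw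
  · rw [← hFK]
    exact isPreconnected_Ioo.image _ hFc.continuousOn
  · intro x hx
    rw [mem_ball]
    refine lt_of_le_of_lt (Metric.dist_le_diam_of_mem hbd (subset_closure hx) hcl) ?_
    rwa [Metric.diam_closure]
end
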